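/- Let n ≥ 2 and let t ∈ ℝ³_H be such that sin(π(t₁−t₂)/3), sin(π(t₂−t₃)/3) and sin(π(t₃−t₁)/3) are all nonzero. Then Φ_n*(t) = (1/(3n²)) [ (1/2)(Θ_n(t) − Θ_{n−2}(t)) − (1/3)( cos(2nπ(t₁−t₂)/3) + cos(2nπ(t₂−t₃)/3) + cos(2nπ(t₃−t₁)/3) ) ]. In particular Φ_n*(t) is real-valued. -/

import Mathlib

open MeasureTheory
open scoped Real Classical

noncomputable section

/-- `φ_j(t) = exp(2πi (j₁t₁ + j₂t₂ + j₃t₃)/3)` for `j ∈ ℤ³`, `t ∈ ℝ³`. -/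
def phi (j : ℤ × ℤ × ℤ) (t : ℝ × ℝ × ℝ) : ℂ :=
  Complex.exp (2 * (Real.pi : ℂ) * Complex.I *
    ((j.1 : ℂ) * (t.1 : ℂ) + (j.2.1 : ℂ) * (t.2.1 : ℂ) + (j.2.2 : ℂ) * (t.2.2 : ℂ)) / 3)

/-- `ℍ_n = {j ∈ ℍ : -n ≤ j₁ < n, -n ≤ j₂ < n, -n ≤ -j₃ < n}`. -/
def Hn (n : ℕ) : Set (ℤ × ℤ × ℤ) :=
  {j | j.1 + j.2.1 + j.2.2 = 0 ∧ -(n : ℤ) ≤ j.1 ∧ j.1 < n ∧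
       -(n : ℤ) ≤ j.2.1 ∧ j.2.1 < n ∧ -(n : ℤ) ≤ -j.2.2 ∧ -j.2.2 < n}

/-- `ℍ_n* = {j ∈ ℍ : -n ≤ j₁, j₂, j₃ ≤ n}`. -/
def Hstar (n : ℕ) : Set (ℤ × ℤ × ℤ) :=
  {j | j.1 + j.2.1 + j.2.2 = 0 ∧ -(n : ℤ) ≤ j.1 ∧ j.1 ≤ n ∧
       -(n : ℤ) ≤ j.2.1 ∧ j.2.1 ≤ n ∧ -(n : ℤ) ≤ j.2.2 ∧ j.2.2 ≤ n}

/-- `ℍ_n° = {j ∈ ℍ : -n < j₁, j₂, j₃ < n}`. -/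
def Hcirc (n : ℕ) : Set (ℤ × ℤ × ℤ) :=
  {j | j.1 + j.2.1 + j.2.2 = 0 ∧ -(n : ℤ) < j.1 ∧ j.1 < n ∧
       -(n : ℤ) < j.2.1 ∧ j.2.1 < n ∧ -(n : ℤ) < j.2.2 ∧ j.2.2 < n}

/-- The weights `c_j^{(n)}`: 1 on interior points, 1/2 on edge points, 1/3 on vertices. -/
def cwt (n : ℕ) (j : ℤ × ℤ × ℤ) : ℝ :=
  if -(n : ℤ) < j.1 ∧ j.1 < n ∧ -(n : ℤ) < j.2.1 ∧ j.2.1 < n ∧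
      -(n : ℤ) < j.2.2 ∧ j.2.2 < n then 1
  else if j.1 * j.2.1 * j.2.2 ≠ 0 then 1 / 2 else 1 / 3

/-- The point `j/n = (j₁/n, j₂/n, j₃/n)`. -/
def pt (n : ℕ) (j : ℤ × ℤ × ℤ) : ℝ × ℝ × ℝ :=
  ((j.1 : ℝ) / n, (j.2.1 : ℝ) / n, (j.2.2 : ℝ) / n)

/-- Homogeneous coordinates `t(x) = (-x₂/2 + √3 x₁/2, x₂, -x₂/2 - √3 x₁/2)`. -/
def Tmap (x : ℝ × ℝ) : ℝ × ℝ × ℝ :=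
  (-x.2 / 2 + Real.sqrt 3 * x.1 / 2, x.2, -x.2 / 2 - Real.sqrt 3 * x.1 / 2)

/-- The planar hexagon `Ω_H` (of area 2√3). -/
def OmegaH : Set (ℝ × ℝ) :=
  {x | -1 ≤ (Tmap x).1 ∧ (Tmap x).1 < 1 ∧ -1 ≤ (Tmap x).2.1 ∧ (Tmap x).2.1 < 1 ∧
       -1 ≤ -(Tmap x).2.2 ∧ -(Tmap x).2.2 < 1}

/-- `⟨f,g⟩_H = (1/(2√3)) ∫_{Ω_H} f(t(x)) conj(g(t(x))) dx`. -/
def innerH (f g : ℝ × ℝ × ℝ → ℂ) : ℂ :=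
  ((1 / (2 * Real.sqrt 3) : ℝ) : ℂ) *
    ∫ x in OmegaH, f (Tmap x) * (starRingEnd ℂ) (g (Tmap x))

/-- `Φ_n*(t) = (1/(3n²)) Σ_{j ∈ ℍ_n*} c_j^{(n)} φ_j(t)`. -/
def PhiStar (n : ℕ) (t : ℝ × ℝ × ℝ) : ℂ :=
  ((1 / (3 * (n : ℝ) ^ 2) : ℝ) : ℂ) * ∑ᶠ j ∈ Hstar n, ((cwt n j : ℝ) : ℂ) * phi j t

/-- `Θ_m(t)`, the quotient of products of sines. -/
def Theta (m : ℕ) (t : ℝ × ℝ × ℝ) : ℝ :=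
  (Real.sin ((m + 1) * Real.pi * (t.1 - t.2.1) / 3) *
   Real.sin ((m + 1) * Real.pi * (t.2.1 - t.2.2) / 3) *
   Real.sin ((m + 1) * Real.pi * (t.2.2 - t.1) / 3)) /
  (Real.sin (Real.pi * (t.1 - t.2.1) / 3) *
   Real.sin (Real.pi * (t.2.1 - t.2.2) / 3) *
   Real.sin (Real.pi * (t.2.2 - t.1) / 3))

/-- The origin together with three half-open rhombi, which tile the hexagon `Hstar n`. -/
def hexFinset (n : ℕ) : Finset (ℤ × ℤ × ℤ) :=
  {(0, 0, 0)} ∪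
    ((Finset.range n ×ˢ Finset.range (n + 1)).image
        (fun p => ((p.1 + 1 : ℤ), (p.2 - (p.1 + 1) : ℤ), (-p.2 : ℤ))) ∪
      ((Finset.range n ×ˢ Finset.range (n + 1)).image
          (fun p => ((-p.2 : ℤ), (p.1 + 1 : ℤ), (p.2 - (p.1 + 1) : ℤ))) ∪
        (Finset.range n ×ˢ Finset.range (n + 1)).image
          (fun p => ((p.2 - (p.1 + 1) : ℤ), (-p.2 : ℤ), (p.1 + 1 : ℤ)))))

theorem mem_hexFinset {n : ℕ} {j : ℤ × ℤ × ℤ} : j ∈ hexFinset n ↔ j ∈ Hstar n := by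
  obtain ⟨a, b, c⟩ := j
  simp only [hexFinset, Hstar, Finset.mem_union, Finset.mem_singleton, Finset.mem_image,
    Finset.mem_product, Finset.mem_range, Prod.exists, Prod.mk.injEq, Set.mem_ofPred_eq]
  constructor
  · rintro (⟨rfl, rfl, rfl⟩ | ⟨p, q, h, rfl, rfl, rfl⟩ | ⟨p, q, h, rfl, rfl, rfl⟩ |
      ⟨p, q, h, rfl, rfl, rfl⟩) <;> omega
  · intro h
    by_cases h0 : a = 0 ∧ b = 0
    · left; omega
    right
    by_cases hA : 0 < a ∧ c ≤ 0
    · left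
      exact ⟨(a - 1).toNat, (-c).toNat, by omega, by omega, by omega, by omega⟩
    right
    by_cases hB : 0 < b ∧ a ≤ 0
    · left
      exact ⟨(b - 1).toNat, (-a).toNat, by omega, by omega, by omega, by omega⟩
    right
    exact ⟨(c - 1).toNat, (-b).toNat, by omega, by omega, by omega, by omega⟩

theorem sum_hexFinset (n : ℕ) (f : ℤ × ℤ × ℤ → ℂ) :
    ∑ j ∈ hexFinset n, f j = f (0, 0, 0) +
      (∑ p ∈ Finset.range n ×ˢ Finset.range (n + 1),
          f ((p.1 + 1 : ℤ), (p.2 - (p.1 + 1) : ℤ), (-p.2 : ℤ)) +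
        (∑ p ∈ Finset.range n ×ˢ Finset.range (n + 1),
            f ((-p.2 : ℤ), (p.1 + 1 : ℤ), (p.2 - (p.1 + 1) : ℤ)) +
          ∑ p ∈ Finset.range n ×ˢ Finset.range (n + 1),
            f ((p.2 - (p.1 + 1) : ℤ), (-p.2 : ℤ), (p.1 + 1 : ℤ)))) := by
  rw [hexFinset, Finset.sum_union, Finset.sum_union, Finset.sum_union, Finset.sum_singleton,
    Finset.sum_image, Finset.sum_image, Finset.sum_image]
  · rintro ⟨p, q⟩ - ⟨p', q'⟩ - h
    simp only [Prod.mk.injEq] at h ⊢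
    omega
  · rintro ⟨p, q⟩ - ⟨p', q'⟩ - h
    simp only [Prod.mk.injEq] at h ⊢
    omega
  · rintro ⟨p, q⟩ - ⟨p', q'⟩ - h
    simp only [Prod.mk.injEq] at h ⊢
    omega
  all_goals
    rw [Finset.disjoint_left]
    rintro ⟨a, b, c⟩ h h'
    simp only [Finset.mem_union, Finset.mem_singleton, Finset.mem_image,
      Finset.mem_product, Finset.mem_range, Prod.exists, Prod.mk.injEq] at h h'
  · obtain ⟨p, q, h⟩ := h
    obtain ⟨p', q', h'⟩ := h'
    omega
  · obtain ⟨p, q, h⟩ := h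
    obtain ⟨p', q', h'⟩ | ⟨p', q', h'⟩ := h' <;> omega
  · obtain ⟨p', q', h'⟩ | ⟨p', q', h'⟩ | ⟨p', q', h'⟩ := h' <;> omega

theorem phi_rotate (a b c : ℤ) (x y z : ℝ) : phi (a, b, c) (x, y, z) = phi (c, a, b) (z, x, y) := by
  simp only [phi]
  ring_nf

theorem phi_eq_pow_mul_pow (p q : ℕ) (x y z : ℝ) :
    phi (p, q - p, -q) (x, y, z) =
      Complex.exp (2 * ((Real.pi * (x - y) / 3 : ℝ) : ℂ) * Complex.I) ^ p *
        Complex.exp (2 * ((Real.pi * (y - z) / 3 : ℝ) : ℂ) * Complex.I) ^ q := by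
  rw [phi, ← Complex.exp_nat_mul, ← Complex.exp_nat_mul, ← Complex.exp_add]
  congr 1
  push_cast
  ring

theorem hexagon_sum_identity {α β γ : ℂ} (h : α * β * γ = 1) (hα : α ≠ 1) (hβ : β ≠ 1)
    (hγ : γ ≠ 1) (m : ℕ) :
    1 + ((∑ p ∈ Finset.range m, α ^ (p + 1)) * (∑ q ∈ Finset.range (m + 1), β ^ q) +
      ((∑ p ∈ Finset.range m, β ^ (p + 1)) * (∑ q ∈ Finset.range (m + 1), γ ^ q) +
       (∑ p ∈ Finset.range m, γ ^ (p + 1)) * (∑ q ∈ Finset.range (m + 1), α ^ q))) =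
    ((α ^ (m + 1) - 1) * (β ^ (m + 1) - 1) * (γ ^ (m + 1) - 1) -
        (α ^ m - 1) * (β ^ m - 1) * (γ ^ m - 1)) /
      ((α - 1) * (β - 1) * (γ - 1)) := by
  have e : ∀ x : ℂ, ∑ p ∈ Finset.range m, x ^ (p + 1) = x * ∑ p ∈ Finset.range m, x ^ p := by
    intro x
    rw [Finset.mul_sum]
    exact Finset.sum_congr rfl fun _ _ => pow_succ' _ _
  have hα' := sub_ne_zero.2 hα
  have hβ' := sub_ne_zero.2 hβ
  have hγ' := sub_ne_zero.2 hγ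
  rw [e, e, e, geom_sum_eq hα, geom_sum_eq hβ, geom_sum_eq hγ, geom_sum_eq hα, geom_sum_eq hβ,
    geom_sum_eq hγ]
  simp only [pow_succ]
  generalize α ^ m = A
  generalize β ^ m = B
  generalize γ ^ m = C
  field_simp
  linear_combination (A * B + B * C + C * A - A - B - C + 1 - A * B * C) * h

theorem sum_phi_hexFinset {α β γ : ℂ} (x y z : ℝ)
    (hα : α = Complex.exp (2 * ((Real.pi * (x - y) / 3 : ℝ) : ℂ) * Complex.I))
    (hβ : β = Complex.exp (2 * ((Real.pi * (y - z) / 3 : ℝ) : ℂ) * Complex.I))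
    (hγ : γ = Complex.exp (2 * ((Real.pi * (z - x) / 3 : ℝ) : ℂ) * Complex.I)) (m : ℕ) :
    ∑ j ∈ hexFinset m, phi j (x, y, z) =
    1 + ((∑ p ∈ Finset.range m, α ^ (p + 1)) * (∑ q ∈ Finset.range (m + 1), β ^ q) +
      ((∑ p ∈ Finset.range m, β ^ (p + 1)) * (∑ q ∈ Finset.range (m + 1), γ ^ q) +
       (∑ p ∈ Finset.range m, γ ^ (p + 1)) * (∑ q ∈ Finset.range (m + 1), α ^ q))) := by
  rw [sum_hexFinset, Finset.sum_mul_sum, Finset.sum_mul_sum, Finset.sum_mul_sum,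
    ← Finset.sum_product', ← Finset.sum_product', ← Finset.sum_product']
  congr 1
  · simp [phi]
  congr 1
  · refine Finset.sum_congr rfl fun p _ => ?_
    rw [hα, hβ, ← phi_eq_pow_mul_pow]
    push_cast
    rfl
  congr 1
  · refine Finset.sum_congr rfl fun p _ => ?_
    rw [hβ, hγ, ← phi_eq_pow_mul_pow, phi_rotate, phi_rotate]
    push_cast
    rfl
  · refine Finset.sum_congr rfl fun p _ => ?_
    rw [hγ, hα, ← phi_eq_pow_mul_pow, phi_rotate]
    push_cast
    rfl

theorem sin_mul_sin_mul_sin_of_add_eq_zero {a b c : ℝ} (h : a + b + c = 0) :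
    ((Real.sin a * Real.sin b * Real.sin c : ℝ) : ℂ) =
      Complex.I / 8 * ((Complex.exp (2 * a * Complex.I) - 1) *
        (Complex.exp (2 * b * Complex.I) - 1) * (Complex.exp (2 * c * Complex.I) - 1)) := by
  have key : ∀ z : ℂ, Complex.sin z =
      -Complex.I / 2 * Complex.exp (-z * Complex.I) * (Complex.exp (2 * z * Complex.I) - 1) := by
    intro z
    rw [mul_sub, mul_assoc _ (Complex.exp _), ← Complex.exp_add, Complex.sin,
      show -z * Complex.I + 2 * z * Complex.I = z * Complex.I by ring]
    ring
  have hexp : Complex.exp (-a * Complex.I) * Complex.exp (-b * Complex.I) *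
      Complex.exp (-c * Complex.I) = 1 := by
    rw [← Complex.exp_add, ← Complex.exp_add, ← Complex.exp_zero]
    congr 1
    have h' : (a + b + c : ℂ) = 0 := by exact_mod_cast h
    linear_combination -Complex.I * h'
  rw [Complex.ofReal_mul, Complex.ofReal_mul, Complex.ofReal_sin, Complex.ofReal_sin,
    Complex.ofReal_sin, key a, key b, key c]
  linear_combination (-Complex.I / 2) ^ 3 * (Complex.exp (2 * a * Complex.I) - 1) *
        (Complex.exp (2 * b * Complex.I) - 1) * (Complex.exp (2 * c * Complex.I) - 1) * hexp -
      Complex.I / 8 * (Complex.exp (2 * a * Complex.I) - 1) *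
        (Complex.exp (2 * b * Complex.I) - 1) * (Complex.exp (2 * c * Complex.I) - 1) *
        Complex.I_sq

theorem Theta_eq_exp (m : ℕ) (x y z : ℝ) {α β γ : ℂ}
    (hα : α = Complex.exp (2 * ((Real.pi * (x - y) / 3 : ℝ) : ℂ) * Complex.I))
    (hβ : β = Complex.exp (2 * ((Real.pi * (y - z) / 3 : ℝ) : ℂ) * Complex.I))
    (hγ : γ = Complex.exp (2 * ((Real.pi * (z - x) / 3 : ℝ) : ℂ) * Complex.I)) :
    (Theta m (x, y, z) : ℂ) =
      ((α ^ (m + 1) - 1) * (β ^ (m + 1) - 1) * (γ ^ (m + 1) - 1)) /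
        ((α - 1) * (β - 1) * (γ - 1)) := by
  have hpow : ∀ s : ℝ, Complex.exp (2 * ((Real.pi * s / 3 : ℝ) : ℂ) * Complex.I) ^ (m + 1) =
      Complex.exp (2 * (((m + 1) * Real.pi * s / 3 : ℝ) : ℂ) * Complex.I) := by
    intro s
    rw [← Complex.exp_nat_mul]
    congr 1
    push_cast
    ring
  simp only [Theta]
  rw [Complex.ofReal_div, sin_mul_sin_mul_sin_of_add_eq_zero, sin_mul_sin_mul_sin_of_add_eq_zero,
    mul_div_mul_left _ _ (by simp [Complex.I_ne_zero]), hα, hβ, hγ, hpow, hpow, hpow]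
  · ring
  · ring

theorem exp_two_mul_I_ne_one {s : ℝ} (h : Real.sin s ≠ 0) :
    Complex.exp (2 * (s : ℂ) * Complex.I) ≠ 1 := by
  intro h'
  obtain ⟨k, hk⟩ := Complex.exp_eq_one_iff.1 h'
  have hs : (s : ℂ) = ((k * Real.pi : ℝ) : ℂ) := by
    have : 2 * Complex.I ≠ 0 := by simp [Complex.I_ne_zero]
    apply mul_left_cancel₀ this
    push_cast
    linear_combination hk
  exact h (by rw [Complex.ofReal_injective hs, Real.sin_int_mul_pi])

/-- The six vertices of the hexagon `Hstar n`. -/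
def hexVertices (n : ℕ) : Finset (ℤ × ℤ × ℤ) :=
  {((n : ℤ), -(n : ℤ), 0), (-(n : ℤ), (n : ℤ), 0), (0, (n : ℤ), -(n : ℤ)),
    (0, -(n : ℤ), (n : ℤ)), (-(n : ℤ), 0, (n : ℤ)), ((n : ℤ), 0, -(n : ℤ))}

theorem cwt_eq (m : ℕ) {j : ℤ × ℤ × ℤ} (hj : j ∈ hexFinset (m + 1)) :
    cwt (m + 1) j = 1 / 2 + (if j ∈ hexFinset m then 1 / 2 else 0) -
      (if j ∈ hexVertices (m + 1) then 1 / 6 else 0) := by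
  obtain ⟨a, b, c⟩ := j
  have hv : (a, b, c) ∈ hexVertices (m + 1) ↔ (a, b, c) ∉ hexFinset m ∧ a * b * c = 0 := by
    rw [mem_hexFinset] at hj ⊢
    simp only [hexVertices, Hstar, Finset.mem_insert, Finset.mem_singleton, Prod.mk.injEq,
      Set.mem_ofPred_eq, mul_eq_zero] at hj ⊢
    push_cast at hj ⊢
    omega
  have hi : (-((m + 1 : ℕ) : ℤ) < a ∧ a < (m + 1 : ℕ) ∧ -((m + 1 : ℕ) : ℤ) < b ∧
      b < (m + 1 : ℕ) ∧ -((m + 1 : ℕ) : ℤ) < c ∧ c < (m + 1 : ℕ)) ↔ (a, b, c) ∈ hexFinset m := by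
    rw [mem_hexFinset] at hj ⊢
    simp only [Hstar, Set.mem_ofPred_eq] at hj ⊢
    push_cast at hj ⊢
    omega
  rw [cwt, if_congr hi rfl rfl, if_congr hv rfl rfl]
  by_cases hm : (a, b, c) ∈ hexFinset m
  · rw [if_pos hm, if_pos hm, if_neg fun h => h.1 hm]
    norm_num
  · by_cases h0 : a * b * c = 0
    · rw [if_neg hm, if_neg hm, if_neg (not_not_intro h0), if_pos ⟨hm, h0⟩]
      norm_num
    · rw [if_neg hm, if_neg hm, if_pos h0, if_neg fun h => h0 h.2]
      norm_num

theorem sum_cwt_mul (m : ℕ) (f : ℤ × ℤ × ℤ → ℂ) :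
    ∑ j ∈ hexFinset (m + 1), ((cwt (m + 1) j : ℝ) : ℂ) * f j =
      1 / 2 * ∑ j ∈ hexFinset (m + 1), f j + 1 / 2 * ∑ j ∈ hexFinset m, f j -
        1 / 6 * ∑ j ∈ hexVertices (m + 1), f j := by
  have h1 : (hexFinset (m + 1)).filter (· ∈ hexFinset m) = hexFinset m := by
    ext ⟨a, b, c⟩
    simp only [Finset.mem_filter, mem_hexFinset, Hstar, Set.mem_ofPred_eq]
    push_cast
    omega
  have h2 : (hexFinset (m + 1)).filter (· ∈ hexVertices (m + 1)) = hexVertices (m + 1) := by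
    rw [Finset.filter_mem_eq_inter, Finset.inter_eq_right]
    intro j hj
    simp only [hexVertices, Finset.mem_insert, Finset.mem_singleton] at hj
    rw [mem_hexFinset]
    rcases hj with rfl | rfl | rfl | rfl | rfl | rfl <;> simp only [Hstar, Set.mem_ofPred_eq] <;>
      omega
  rw [← h1, ← h2, Finset.sum_filter, Finset.sum_filter, Finset.mul_sum, Finset.mul_sum,
    Finset.mul_sum, ← Finset.sum_add_distrib, ← Finset.sum_sub_distrib]
  refine Finset.sum_congr rfl fun j hj => ?_
  rw [cwt_eq m hj]
  split_ifs <;> push_cast <;> ring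

theorem sum_hexVertices (m : ℕ) (t : ℝ × ℝ × ℝ) :
    ∑ j ∈ hexVertices (m + 1), phi j t =
      ((2 * (Real.cos (2 * (m + 1 : ℕ) * Real.pi * (t.1 - t.2.1) / 3) +
        Real.cos (2 * (m + 1 : ℕ) * Real.pi * (t.2.1 - t.2.2) / 3) +
        Real.cos (2 * (m + 1 : ℕ) * Real.pi * (t.2.2 - t.1) / 3)) : ℝ) : ℂ) := by
  rw [hexVertices]
  repeat rw [Finset.sum_insert (by
    simp only [Finset.mem_insert, Finset.mem_singleton, Prod.mk.injEq]; omega)]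
  rw [Finset.sum_singleton]
  simp only [Complex.ofReal_mul, Complex.ofReal_add, Complex.ofReal_cos, Complex.cos, phi]
  push_cast
  ring_nf

theorem stmt_7 (n : ℕ) (hn : 2 ≤ n) (t : ℝ × ℝ × ℝ)
    (ht : t.1 + t.2.1 + t.2.2 = 0)
    (h1 : Real.sin (Real.pi * (t.1 - t.2.1) / 3) ≠ 0)
    (h2 : Real.sin (Real.pi * (t.2.1 - t.2.2) / 3) ≠ 0)
    (h3 : Real.sin (Real.pi * (t.2.2 - t.1) / 3) ≠ 0) :
    PhiStar n t =
      (((1 / (3 * (n : ℝ) ^ 2)) *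
        ((1 / 2) * (Theta n t - Theta (n - 2) t) -
          (1 / 3) * (Real.cos (2 * n * Real.pi * (t.1 - t.2.1) / 3) +
                     Real.cos (2 * n * Real.pi * (t.2.1 - t.2.2) / 3) +
                     Real.cos (2 * n * Real.pi * (t.2.2 - t.1) / 3))) : ℝ) : ℂ) := by
  obtain ⟨m, rfl⟩ : ∃ m, n = m + 1 + 1 := ⟨n - 2, by omega⟩
  obtain ⟨x, y, z⟩ := t
  obtain ⟨α, hα⟩ : ∃ α, α = Complex.exp (2 * ((Real.pi * (x - y) / 3 : ℝ) : ℂ) * Complex.I) :=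
    ⟨_, rfl⟩
  obtain ⟨β, hβ⟩ : ∃ β, β = Complex.exp (2 * ((Real.pi * (y - z) / 3 : ℝ) : ℂ) * Complex.I) :=
    ⟨_, rfl⟩
  obtain ⟨γ, hγ⟩ : ∃ γ, γ = Complex.exp (2 * ((Real.pi * (z - x) / 3 : ℝ) : ℂ) * Complex.I) :=
    ⟨_, rfl⟩
  have hα1 : α ≠ 1 := hα ▸ exp_two_mul_I_ne_one h1
  have hβ1 : β ≠ 1 := hβ ▸ exp_two_mul_I_ne_one h2
  have hγ1 : γ ≠ 1 := hγ ▸ exp_two_mul_I_ne_one h3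
  have hprod : α * β * γ = 1 := by
    rw [hα, hβ, hγ, ← Complex.exp_add, ← Complex.exp_add, ← Complex.exp_zero]
    congr 1
    push_cast
    ring
  have hset : Hstar (m + 1 + 1) = (hexFinset (m + 1 + 1) : Set (ℤ × ℤ × ℤ)) := by
    ext j
    rw [Finset.mem_coe, mem_hexFinset]
  rw [PhiStar, Complex.ofReal_mul]
  congr 1
  rw [hset, finsum_mem_coe_finset, sum_cwt_mul, sum_hexVertices, sum_phi_hexFinset x y z hα hβ hγ,
    sum_phi_hexFinset x y z hα hβ hγ, hexagon_sum_identity hprod hα1 hβ1 hγ1,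
    hexagon_sum_identity hprod hα1 hβ1 hγ1, show m + 1 + 1 - 2 = m by omega,
    Complex.ofReal_mul]
  simp only [Complex.ofReal_sub, Complex.ofReal_mul, Theta_eq_exp _ x y z hα hβ hγ]
  push_cast
  ring
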